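/- Let G be a finite connected graph and let 𝒯 = (T_w)_{w∈V} be a collection where each T_w is a BFS-tree of G rooted at w. Let ρ_𝒯(G) = max_{w∈V} ρ_{w,T_w}(G), and let κ_𝒯(G) = max{κ_{T_u}(u,v) : u,v ∈ V}, where for the path (u = u_0, u_1, …, u_ℓ = v) joining u and v in T_u one sets κ_{T_u}(u,v) = max{d(a,u_i) : a ∈ I(u,v), d(a,u) = i}. Then ι(G) = τ(G) ≤ ρ_𝒯(G) + 2·κ_𝒯(G) ≤ 3·ρ_𝒯(G) ≤ 3·τ(G), and ς(G) ≤ ρ_𝒯(G) + 2·κ_𝒯(G) ≤ 8·ς(G). -/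

import Mathlib

open SimpleGraph

noncomputable section

namespace HypPaper

variable {V : Type*}

/-- Gromov product `(y|z)_w = (d(y,w)+d(z,w)-d(y,z))/2`. -/
def gp (G : SimpleGraph V) (y z w : V) : ℝ :=
  ((G.dist y w : ℝ) + (G.dist z w : ℝ) - (G.dist y z : ℝ)) / 2

/-- `G` is `δ`-hyperbolic. -/
def IsDeltaHyp (G : SimpleGraph V) (δ : ℝ) : Prop :=
  ∀ w x y z : V, gp G x y w ≥ min (gp G x z w) (gp G y z w) - δ

/-- The hyperbolicity `δ(G)`: least `δ ≥ 0` such that `G` is `δ`-hyperbolic. -/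
def hyperbolicity (G : SimpleGraph V) : ℝ :=
  sInf {δ : ℝ | 0 ≤ δ ∧ IsDeltaHyp G δ}

/-- Pointed hyperbolicity `δ_w(G)` with respect to basepoint `w`. -/
def pointedHyp (G : SimpleGraph V) (w : V) : ℝ :=
  sInf {δ : ℝ | ∀ x y z : V, gp G x y w ≥ min (gp G x z w) (gp G y z w) - δ}

/-- A walk is a geodesic (shortest path) if its length equals the distance. -/
def IsGeodesic (G : SimpleGraph V) {x y : V} (p : G.Walk x y) : Prop :=
  p.length = G.dist x y

/-- Thinness condition at corner `v` of a triangle, with sides `p : v → u` and `q : v → u'`. -/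
def ThinCorner (G : SimpleGraph V) (δ : ℝ) {v u u' : V}
    (p : G.Walk v u) (q : G.Walk v u') : Prop :=
  ∀ a ∈ p.support, ∀ b ∈ q.support,
    G.dist v a = G.dist v b → (G.dist v a : ℝ) ≤ gp G u u' v →
    (G.dist a b : ℝ) ≤ δ

/-- A geodesic triangle with sides `p : x → y`, `q : y → z`, `r : z → x` is `δ`-thin. -/
def TriangleThin (G : SimpleGraph V) (δ : ℝ) {x y z : V}
    (p : G.Walk x y) (q : G.Walk y z) (r : G.Walk z x) : Prop :=
  ThinCorner G δ p r.reverse ∧ ThinCorner G δ q p.reverse ∧ ThinCorner G δ r q.reverse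

/-- Thinness `τ(G)`: least `δ` such that every geodesic triangle is `δ`-thin. -/
def thinness (G : SimpleGraph V) : ℝ :=
  sInf {δ : ℝ | ∀ (x y z : V) (p : G.Walk x y) (q : G.Walk y z) (r : G.Walk z x),
    IsGeodesic G p → IsGeodesic G q → IsGeodesic G r → TriangleThin G δ p q r}

/-- The insize `max {d(y_z,z_y), d(z_x,x_z), d(x_y,y_x)}` of a geodesic triangle with
sides `p : x → y`, `q : y → z`, `r : z → x`. -/
def triInsize (G : SimpleGraph V) {x y z : V}
    (p : G.Walk x y) (q : G.Walk y z) (r : G.Walk z x) : ℝ :=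
  max (G.dist (p.getVert ⌊gp G y z x⌋₊) (r.reverse.getVert ⌊gp G y z x⌋₊) : ℝ)
    (max (G.dist (q.getVert ⌊gp G z x y⌋₊) (p.reverse.getVert ⌊gp G z x y⌋₊) : ℝ)
      (G.dist (r.getVert ⌊gp G x y z⌋₊) (q.reverse.getVert ⌊gp G x y z⌋₊) : ℝ))

/-- Insize `ι(G)`: least upper bound on insizes of geodesic triangles. -/
def insize (G : SimpleGraph V) : ℝ :=
  sInf {δ : ℝ | ∀ (x y z : V) (p : G.Walk x y) (q : G.Walk y z) (r : G.Walk z x),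
    IsGeodesic G p → IsGeodesic G q → IsGeodesic G r → triInsize G p q r ≤ δ}

/-- A geodesic triangle with sides `p : x → y`, `q : y → z`, `r : z → x` is `δ`-slim. -/
def TriangleSlim (G : SimpleGraph V) (δ : ℝ) {x y z : V}
    (p : G.Walk x y) (q : G.Walk y z) (r : G.Walk z x) : Prop :=
  (∀ a ∈ p.support, ∃ b, (b ∈ q.support ∨ b ∈ r.support) ∧ (G.dist a b : ℝ) ≤ δ) ∧
  (∀ a ∈ q.support, ∃ b, (b ∈ r.support ∨ b ∈ p.support) ∧ (G.dist a b : ℝ) ≤ δ) ∧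
  (∀ a ∈ r.support, ∃ b, (b ∈ p.support ∨ b ∈ q.support) ∧ (G.dist a b : ℝ) ≤ δ)

/-- Slimness `ς(G)`: least `δ` such that every geodesic triangle is `δ`-slim. -/
def slimness (G : SimpleGraph V) : ℝ :=
  sInf {δ : ℝ | ∀ (x y z : V) (p : G.Walk x y) (q : G.Walk y z) (r : G.Walk z x),
    IsGeodesic G p → IsGeodesic G q → IsGeodesic G r → TriangleSlim G δ p q r}

/-- The metric interval `I(u,v)`. -/
def interval (G : SimpleGraph V) (u v : V) : Set V :=
  {x | G.dist u x + G.dist x v = G.dist u v}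

/-- Interval thinness `κ(G)`. -/
def intervalThinness (G : SimpleGraph V) : ℝ :=
  sInf {κ : ℝ | ∀ x y a b : V, a ∈ interval G x y → b ∈ interval G x y →
    G.dist x a = G.dist x b → (G.dist a b : ℝ) ≤ κ}

/-- A BFS-tree of `G` rooted at `w`: a spanning tree (encoded by its parent function)
in which the path from `w` to any vertex is a shortest path of `G`. -/
structure BFSTree (G : SimpleGraph V) (w : V) where
  parent : V → V
  parent_root : parent w = w
  adj_parent : ∀ x, x ≠ w → G.Adj (parent x) x
  dist_parent : ∀ x, x ≠ w → G.dist w (parent x) + 1 = G.dist w x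

/-- The vertex of the tree path `[w,x]_T` at distance `r` from the root `w`
(for `r ≤ d(w,x)`). -/
def treeVert (G : SimpleGraph V) {w : V} (T : BFSTree G w) (x : V) (r : ℕ) : V :=
  T.parent^[G.dist w x - r] x

/-- `v` lies on the tree path `[w,x]_T`. -/
def onRootPath (G : SimpleGraph V) {w : V} (T : BFSTree G w) (x v : V) : Prop :=
  ∃ i ≤ G.dist w x, v = T.parent^[i] x

/-- The rooted insize `ρ_{w,T}(G) = max {d(x_y, y_x) : x, y ∈ V}`, where `x_y`, `y_x` are
the vertices of `[w,x]_T`, `[w,y]_T` at distance `⌊(x|y)_w⌋` from `w`. -/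
def rootedInsize (G : SimpleGraph V) {w : V} (T : BFSTree G w) : ℝ :=
  sSup {ρ : ℝ | ∃ x y : V,
    ρ = (G.dist (treeVert G T x ⌊gp G x y w⌋₊) (treeVert G T y ⌊gp G x y w⌋₊) : ℝ)}

/-- The rooted thinness `μ_{w,T}(G)`. -/
def rootedThinness (G : SimpleGraph V) {w : V} (T : BFSTree G w) : ℝ :=
  sSup {μ : ℝ | ∃ x y x' y' : V, onRootPath G T x x' ∧ onRootPath G T y y' ∧
    G.dist w x' = G.dist w y' ∧ (G.dist w x' : ℝ) ≤ gp G x y w ∧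
    μ = (G.dist x' y' : ℝ)}


namespace IsGeodesic

variable {G : SimpleGraph V} {x y : V} {p : G.Walk x y}

lemma reverse (hp : IsGeodesic G p) : IsGeodesic G p.reverse := by
  rw [IsGeodesic, Walk.length_reverse, hp, dist_comm]

lemma dist_getVert_getVert_le (p : G.Walk x y) {i j : ℕ} (hij : i ≤ j) :
    G.dist (p.getVert i) (p.getVert j) ≤ j - i := by
  have h := dist_le ((p.drop i).take (j - i))
  rw [Walk.take_length, Walk.drop_length, Walk.drop_getVert, Nat.add_sub_cancel' hij] at h
  omega

lemma dist_left_getVert (hG : G.Connected) (hp : IsGeodesic G p) {i : ℕ}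
    (hi : i ≤ G.dist x y) : G.dist x (p.getVert i) = i := by
  have h₁ := dist_getVert_getVert_le p (Nat.zero_le i)
  have h₂ := dist_getVert_getVert_le p (hi.trans hp.ge)
  rw [Walk.getVert_zero] at h₁
  rw [Walk.getVert_length] at h₂
  have h₃ := hG.dist_triangle (u := x) (v := p.getVert i) (w := y)
  rw [hp] at h₂
  omega

lemma getVert_mem_interval (hG : G.Connected) (hp : IsGeodesic G p) {i : ℕ}
    (hi : i ≤ G.dist x y) : p.getVert i ∈ interval G x y := by
  have h₁ := dist_left_getVert hG hp hi
  have h₂ := dist_getVert_getVert_le p (hi.trans hp.ge)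
  rw [Walk.getVert_length, hp] at h₂
  have h₃ := hG.dist_triangle (u := x) (v := p.getVert i) (w := y)
  change _ + _ = _
  omega

lemma exists_getVert_of_mem_support (hp : IsGeodesic G p) {a : V} (ha : a ∈ p.support) :
    ∃ i ≤ G.dist x y, p.getVert i = a := by
  obtain ⟨i, h, hi⟩ := Walk.mem_support_iff_exists_getVert.1 ha
  exact ⟨i, hi.trans hp.le, h⟩

lemma mem_interval (hG : G.Connected) (hp : IsGeodesic G p) {a : V} (ha : a ∈ p.support) :
    a ∈ interval G x y := by
  obtain ⟨i, hi, rfl⟩ := hp.exists_getVert_of_mem_support ha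
  exact hp.getVert_mem_interval hG hi

lemma dist_add_dist_le (hG : G.Connected) (hp : IsGeodesic G p) {a b : V}
    (ha : a ∈ p.support) (hb : b ∈ p.support) (hab : G.dist x a ≤ G.dist x b) :
    G.dist x a + G.dist a b ≤ G.dist x b := by
  obtain ⟨i, hi, rfl⟩ := hp.exists_getVert_of_mem_support ha
  obtain ⟨j, hj, rfl⟩ := hp.exists_getVert_of_mem_support hb
  rw [hp.dist_left_getVert hG hi, hp.dist_left_getVert hG hj] at *
  have := dist_getVert_getVert_le p hab
  omega

lemma dist_le_abs_sub (hG : G.Connected) (hp : IsGeodesic G p) {a b : V}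
    (ha : a ∈ p.support) (hb : b ∈ p.support) :
    (G.dist a b : ℝ) ≤ |(G.dist x a : ℝ) - G.dist x b| := by
  rcases le_total (G.dist x a) (G.dist x b) with h | h
  · have := hp.dist_add_dist_le hG ha hb h
    rw [abs_sub_comm]
    refine le_trans ?_ (le_abs_self _)
    rify at this
    linarith
  · have := hp.dist_add_dist_le hG hb ha h
    rw [G.dist_comm (u := b)] at this
    refine le_trans ?_ (le_abs_self _)
    rify at this
    linarith

end IsGeodesic

variable {G : SimpleGraph V}

lemma mem_interval_comm {u v a : V} : a ∈ interval G u v ↔ a ∈ interval G v u := by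
  simp only [interval, Set.mem_ofPred_eq, G.dist_comm (u := u), G.dist_comm (v := v)]
  rw [add_comm]

lemma exists_isGeodesic (hG : G.Connected) (x y : V) : ∃ p : G.Walk x y, IsGeodesic G p :=
  hG.exists_walk_length_eq_dist x y

lemma exists_isGeodesic_getVert_eq (hG : G.Connected) {x y a : V} (ha : a ∈ interval G x y) :
    ∃ p : G.Walk x y, IsGeodesic G p ∧ p.getVert (G.dist x a) = a := by
  obtain ⟨p, hp⟩ := exists_isGeodesic hG x a
  obtain ⟨q, hq⟩ := exists_isGeodesic hG a y
  rw [IsGeodesic] at hp hq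
  refine ⟨p.append q, ?_, ?_⟩
  · rw [IsGeodesic, Walk.length_append, hp, hq]
    exact ha
  · simp [Walk.getVert_append, hp]

lemma exists_isGeodesic_mem_support (hG : G.Connected) {x y a : V} (ha : a ∈ interval G x y) :
    ∃ p : G.Walk x y, IsGeodesic G p ∧ a ∈ p.support := by
  obtain ⟨p, hp, h⟩ := exists_isGeodesic_getVert_eq hG ha
  exact ⟨p, hp, h ▸ p.getVert_mem_support _⟩

lemma natCast_le_gp (x y w : V) (k : ℕ) :
    (k : ℝ) ≤ gp G x y w ↔ 2 * k + G.dist x y ≤ G.dist w x + G.dist w y := by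
  rw [gp, le_div_iff₀ two_pos, le_sub_iff_add_le, G.dist_comm (u := x) (v := w),
    G.dist_comm (u := y) (v := w), mul_comm]
  norm_cast

lemma floor_gp_eq_iff (hG : G.Connected) (x y w : V) (k : ℕ) :
    ⌊gp G x y w⌋₊ = k ↔ 2 * k + G.dist x y ≤ G.dist w x + G.dist w y ∧
      G.dist w x + G.dist w y ≤ 2 * k + 1 + G.dist x y := by
  have h := hG.dist_triangle (u := x) (v := w) (w := y)
  rw [G.dist_comm (u := x) (v := w)] at h
  have h₀ : 0 ≤ gp G x y w := by
    exact_mod_cast (natCast_le_gp x y w 0).2 (by omega)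
  rw [Nat.floor_eq_iff h₀, natCast_le_gp, ← not_le, ← Nat.cast_succ, natCast_le_gp]
  omega

/-- Vertices of `I(v,u)` and `I(v,u')` at the same distance from `v`, not exceeding the Gromov
product `(u|u')_v`, are at distance at most `c`. -/
def ThinBound (G : SimpleGraph V) (c : ℝ) : Prop :=
  ∀ v u u' a b : V, a ∈ interval G v u → b ∈ interval G v u' → G.dist v a = G.dist v b →
    2 * G.dist v a + G.dist u u' ≤ G.dist v u + G.dist v u' → (G.dist a b : ℝ) ≤ c

/-- Vertices of `I(v,u)` and `I(v,u')` at distance `⌊(u|u')_v⌋` from `v` are at distance at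
most `c`. -/
def InsizeBound (G : SimpleGraph V) (c : ℝ) : Prop :=
  ∀ v u u' a b : V, a ∈ interval G v u → b ∈ interval G v u' → G.dist v a = G.dist v b →
    2 * G.dist v a + G.dist u u' ≤ G.dist v u + G.dist v u' →
    G.dist v u + G.dist v u' ≤ 2 * G.dist v a + 1 + G.dist u u' → (G.dist a b : ℝ) ≤ c

lemma InsizeBound.thinBound (hG : G.Connected) {c : ℝ} (h : InsizeBound G c) :
    ThinBound G c := by
  classical
  intro v u u' a b ha hb hab hle
  obtain ⟨q, hq, hqb⟩ := exists_isGeodesic_getVert_eq hG hb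
  have hb' : G.dist v b + G.dist b u' = G.dist v u' := hb
  have hex : ∃ j, G.dist v b ≤ j ∧ j ≤ G.dist v u' ∧
      2 * G.dist v b + G.dist u (q.getVert j) ≤ G.dist v u + j := by
    refine ⟨G.dist v u', by omega, le_rfl, ?_⟩
    rw [← hq, Walk.getVert_length, hq]
    omega
  obtain ⟨hj₁, hj₂, hj₃⟩ := Nat.find_spec hex
  have hmin := fun m => Nat.find_min hex (m := m)
  generalize Nat.find hex = j at *
  have hvj := hq.dist_left_getVert hG hj₂
  refine h v u (q.getVert j) a b ha ?_ hab (by omega) ?_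
  · have h₁ := IsGeodesic.dist_getVert_getVert_le q hj₁
    rw [hqb] at h₁
    have := hG.dist_triangle (u := v) (v := b) (w := q.getVert j)
    change _ + _ = _
    omega
  · rw [hvj]
    rcases hj₁.eq_or_lt with rfl | hlt
    · have := hG.dist_triangle (u := v) (v := q.getVert (G.dist v b)) (w := u)
      rw [hvj, G.dist_comm (u := q.getVert _)] at this
      omega
    · have h₁ := hmin (j - 1) (by omega)
      have h₂ := IsGeodesic.dist_getVert_getVert_le q (Nat.sub_le j 1)
      have := hG.dist_triangle (u := u) (v := q.getVert j) (w := q.getVert (j - 1))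
      rw [G.dist_comm (u := q.getVert j)] at this
      omega

lemma thinBound_iff_insizeBound (hG : G.Connected) {c : ℝ} : ThinBound G c ↔ InsizeBound G c :=
  ⟨fun h v u u' a b ha hb hab hle _ => h v u u' a b ha hb hab hle, fun h => h.thinBound hG⟩

lemma ThinBound.thinCorner (hG : G.Connected) {c : ℝ} (h : ThinBound G c) {v u u' : V}
    {p : G.Walk v u} {q : G.Walk v u'} (hp : IsGeodesic G p) (hq : IsGeodesic G q) :
    ThinCorner G c p q := fun _ ha _ hb hab hle =>
  h v u u' _ _ (hp.mem_interval hG ha) (hq.mem_interval hG hb) hab ((natCast_le_gp _ _ _ _).1 hle)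

lemma thinness_eq_sInf_thinBound (hG : G.Connected) :
    thinness G = sInf {c | ThinBound G c} := by
  refine congrArg sInf (Set.ext fun c => ⟨fun h v u u' a b ha hb hab hle => ?_,
    fun h x y z p q r hp hq hr => ⟨h.thinCorner hG hp hr.reverse,
      h.thinCorner hG hq hp.reverse, h.thinCorner hG hr hq.reverse⟩⟩)
  obtain ⟨p, hp, hpa⟩ := exists_isGeodesic_mem_support hG ha
  obtain ⟨r, hr, hrb⟩ := exists_isGeodesic_mem_support hG hb
  obtain ⟨q, hq⟩ := exists_isGeodesic hG u u'
  exact (h v u u' p q r.reverse hp hq hr.reverse).1 a hpa b (by simpa using hrb) hab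
    ((natCast_le_gp _ _ _ _).2 hle)

lemma InsizeBound.dist_getVert_le (hG : G.Connected) {c : ℝ} (h : InsizeBound G c) {v u u' : V}
    {p : G.Walk v u} {q : G.Walk v u'} (hp : IsGeodesic G p) (hq : IsGeodesic G q) :
    (G.dist (p.getVert ⌊gp G u u' v⌋₊) (q.getVert ⌊gp G u u' v⌋₊) : ℝ) ≤ c := by
  obtain ⟨h₁, h₂⟩ := (floor_gp_eq_iff hG u u' v _).1 rfl
  have h₃ := hG.dist_triangle (u := v) (v := u) (w := u')
  have h₄ := hG.dist_triangle (u := v) (v := u') (w := u)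
  rw [G.dist_comm (u := u') (v := u)] at h₄
  have hku : ⌊gp G u u' v⌋₊ ≤ G.dist v u := by omega
  have hku' : ⌊gp G u u' v⌋₊ ≤ G.dist v u' := by omega
  have h₅ := hp.dist_left_getVert hG hku
  have h₆ := hq.dist_left_getVert hG hku'
  exact h v u u' _ _ (hp.getVert_mem_interval hG hku) (hq.getVert_mem_interval hG hku')
    (h₅.trans h₆.symm) (by omega) (by omega)

lemma insize_eq_sInf_insizeBound (hG : G.Connected) :
    insize G = sInf {c | InsizeBound G c} := by
  refine congrArg sInf (Set.ext fun c => ⟨fun h v u u' a b ha hb hab hle hge => ?_,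
    fun h x y z p q r hp hq hr => max_le (h.dist_getVert_le hG hp hr.reverse)
      (max_le (h.dist_getVert_le hG hq hp.reverse) (h.dist_getVert_le hG hr hq.reverse))⟩)
  obtain ⟨p, hp, hpa⟩ := exists_isGeodesic_getVert_eq hG ha
  obtain ⟨r, hr, hrb⟩ := exists_isGeodesic_getVert_eq hG hb
  obtain ⟨q, hq⟩ := exists_isGeodesic hG u u'
  have := (le_max_left _ _).trans (h v u u' p q r.reverse hp hq hr.reverse)
  rwa [(floor_gp_eq_iff hG u u' v _).2 ⟨hle, hge⟩, Walk.reverse_reverse, hpa, hab, hrb] at this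

lemma insize_eq_thinness (hG : G.Connected) : insize G = thinness G := by
  simp_rw [insize_eq_sInf_insizeBound hG, thinness_eq_sInf_thinBound hG,
    thinBound_iff_insizeBound hG]

lemma ThinBound.nonneg (hG : G.Connected) {c : ℝ} (h : ThinBound G c) : 0 ≤ c := by
  obtain ⟨v⟩ := hG.nonempty
  simpa using h v v v v v (by simp [interval]) (by simp [interval]) rfl (by simp)

lemma ThinBound.thinness_le (hG : G.Connected) {c : ℝ} (h : ThinBound G c) : thinness G ≤ c := by
  rw [thinness_eq_sInf_thinBound hG]
  exact csInf_le ⟨0, fun _ hd => ThinBound.nonneg hG hd⟩ h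

lemma ThinBound.exists_dist_le (hG : G.Connected) {c : ℝ} (h : ThinBound G c) {x y z : V}
    {p : G.Walk x y} {q : G.Walk y z} {r : G.Walk z x} (hp : IsGeodesic G p)
    (hq : IsGeodesic G q) (hr : IsGeodesic G r) {a : V} (ha : a ∈ p.support) :
    ∃ b, (b ∈ q.support ∨ b ∈ r.support) ∧ (G.dist a b : ℝ) ≤ c := by
  have ha' := hp.mem_interval hG ha
  have hxy : G.dist x a + G.dist a y = G.dist x y := ha'
  have h₁ := hG.dist_triangle (u := x) (v := z) (w := y)
  have h₂ := hG.dist_triangle (u := x) (v := y) (w := z)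
  have h₃ := hG.dist_triangle (u := y) (v := x) (w := z)
  have e₁ := G.dist_comm (u := a) (v := y)
  have e₂ := G.dist_comm (u := z) (v := y)
  have e₃ := G.dist_comm (u := y) (v := x)
  by_cases hle : 2 * G.dist x a + G.dist y z ≤ G.dist x y + G.dist x z
  · have hi : G.dist x a ≤ G.dist x z := by omega
    refine ⟨r.reverse.getVert (G.dist x a), Or.inr ?_, ?_⟩
    · simpa using r.reverse.getVert_mem_support (G.dist x a)
    · exact h x y z _ _ ha' (hr.reverse.getVert_mem_interval hG hi)
        (hr.reverse.dist_left_getVert hG hi).symm hle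
  · have hi : G.dist y a ≤ G.dist y z := by omega
    refine ⟨q.getVert (G.dist y a), Or.inl (q.getVert_mem_support _), ?_⟩
    exact h y x z _ _ (mem_interval_comm.1 ha') (hq.getVert_mem_interval hG hi)
      (hq.dist_left_getVert hG hi).symm (by omega)

lemma ThinBound.triangleSlim (hG : G.Connected) {c : ℝ} (h : ThinBound G c) {x y z : V}
    {p : G.Walk x y} {q : G.Walk y z} {r : G.Walk z x} (hp : IsGeodesic G p)
    (hq : IsGeodesic G q) (hr : IsGeodesic G r) : TriangleSlim G c p q r :=
  ⟨fun _ => h.exists_dist_le hG hp hq hr, fun _ => h.exists_dist_le hG hq hr hp,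
    fun _ => h.exists_dist_le hG hr hp hq⟩

/-- Every geodesic triangle of `G` is `c`-slim. -/
def SlimBound (G : SimpleGraph V) (c : ℝ) : Prop :=
  ∀ (x y z : V) (p : G.Walk x y) (q : G.Walk y z) (r : G.Walk z x),
    IsGeodesic G p → IsGeodesic G q → IsGeodesic G r → TriangleSlim G c p q r

lemma ThinBound.slimBound (hG : G.Connected) {c : ℝ} (h : ThinBound G c) : SlimBound G c :=
  fun _ _ _ _ _ _ hp hq hr => h.triangleSlim hG hp hq hr

lemma SlimBound.nonneg (hG : G.Connected) {c : ℝ} (h : SlimBound G c) : 0 ≤ c := by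
  obtain ⟨v⟩ := hG.nonempty
  have hv : IsGeodesic G (Walk.nil : G.Walk v v) := by simp [IsGeodesic]
  obtain ⟨b, -, hb⟩ := (h v v v _ _ _ hv hv hv).1 v (by simp)
  exact (Nat.cast_nonneg _).trans hb

lemma SlimBound.slimness_le (hG : G.Connected) {c : ℝ} (h : SlimBound G c) : slimness G ≤ c :=
  csInf_le ⟨0, fun _ hd => SlimBound.nonneg hG hd⟩ h

lemma dist_le_two_mul_of_near (hG : G.Connected) {v u' x' y' b : V} {q : G.Walk v u'}
    (hq : IsGeodesic G q) {c : ℝ} (hy : y' ∈ q.support) (hb : b ∈ q.support)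
    (he : G.dist v x' = G.dist v y') (hle : (G.dist x' b : ℝ) ≤ c) :
    (G.dist x' y' : ℝ) ≤ 2 * c := by
  have h₁ := hq.dist_le_abs_sub hG hb hy
  have h₂ := hG.dist_triangle (u := v) (v := x') (w := b)
  have h₃ := hG.dist_triangle (u := v) (v := b) (w := x')
  have h₄ := hG.dist_triangle (u := x') (v := b) (w := y')
  rw [G.dist_comm (u := b)] at h₃
  have h₅ : |(G.dist v b : ℝ) - G.dist v y'| ≤ G.dist x' b := by
    rw [← he, abs_sub_le_iff]
    rify at h₂ h₃
    constructor <;> linarith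
  rify at h₄
  linarith

lemma SlimBound.dist_le_two_mul (hG : G.Connected) {c : ℝ} (h : SlimBound G c) {u v a b : V}
    (ha : a ∈ interval G u v) (hb : b ∈ interval G u v) (hab : G.dist u a = G.dist u b) :
    (G.dist a b : ℝ) ≤ 2 * c := by
  obtain ⟨p, hp, hpa⟩ := exists_isGeodesic_mem_support hG ha
  obtain ⟨q, hq, hqb⟩ := exists_isGeodesic_mem_support hG hb
  obtain ⟨b', hb', hle⟩ := (h u v v p Walk.nil q.reverse hp (by simp [IsGeodesic])
    hq.reverse).1 a hpa
  have hb'q : b' ∈ q.support := by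
    rcases hb' with hb' | hb'
    · rw [Walk.support_nil, List.mem_singleton] at hb'
      exact hb' ▸ q.end_mem_support
    · simpa using hb'
  exact dist_le_two_mul_of_near hG hq hqb hb'q hab hle

lemma SlimBound.insizeBound (hG : G.Connected) {c : ℝ} (h : SlimBound G c) :
    InsizeBound G (4 * c) := by
  intro w x y x' y' hx hy he hle hge
  have hc := h.nonneg hG
  obtain ⟨p, hp, hpx⟩ := exists_isGeodesic_mem_support hG hx
  obtain ⟨q, hq, hqy⟩ := exists_isGeodesic_mem_support hG hy
  obtain ⟨r, hr⟩ := exists_isGeodesic hG x y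
  have hslim := h w x y p r q.reverse hp hr hq.reverse
  obtain ⟨s, hs, hxs⟩ := hslim.1 x' hpx
  obtain ⟨t, ht, hyt⟩ := hslim.2.2 y' (by simpa using hqy)
  rcases hs with hs | hs
  swap
  · have := dist_le_two_mul_of_near hG hq hqy (by simpa using hs) he hxs
    linarith
  rcases ht with ht | ht
  · have := dist_le_two_mul_of_near hG hp hpx ht he.symm hyt
    rw [dist_comm] at this
    linarith
  have hst := hr.dist_le_abs_sub hG hs ht
  have hx' : G.dist w x' + G.dist x' x = G.dist w x := hx
  have hy' : G.dist w y' + G.dist y' y = G.dist w y := hy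
  have hs' : G.dist x s + G.dist s y = G.dist x y := hr.mem_interval hG hs
  have ht' : G.dist x t + G.dist t y = G.dist x y := hr.mem_interval hG ht
  have t₁ := hG.dist_triangle (u := x') (v := s) (w := y')
  have t₂ := hG.dist_triangle (u := s) (v := t) (w := y')
  have t₃ := hG.dist_triangle (u := x') (v := s) (w := x)
  have t₄ := hG.dist_triangle (u := y') (v := t) (w := y)
  have t₅ := hG.dist_triangle (u := w) (v := s) (w := y)
  have t₆ := hG.dist_triangle (u := w) (v := x') (w := s)
  have t₇ := hG.dist_triangle (u := w) (v := t) (w := x)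
  have t₈ := hG.dist_triangle (u := w) (v := y') (w := t)
  rw [G.dist_comm (u := t) (v := y')] at t₂
  rw [G.dist_comm (u := s) (v := x)] at t₃
  rw [G.dist_comm (u := t) (v := x)] at t₇
  have hst' : |(G.dist x s : ℝ) - G.dist x t| ≤ 2 * c := by
    rw [abs_sub_le_iff]
    rify at *
    constructor <;> linarith
  rify at t₁ t₂
  linarith

lemma BFSTree.dist_iterate_parent {w : V} (T : BFSTree G w) (x : V) (i : ℕ)
    (hi : i ≤ G.dist w x) :
    G.dist w (T.parent^[i] x) + i = G.dist w x ∧ G.dist (T.parent^[i] x) x ≤ i ∧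
      G.Reachable (T.parent^[i] x) x := by
  induction i with
  | zero => simp
  | succ i ih =>
    obtain ⟨h₁, h₂, h₃⟩ := ih (by omega)
    have hne : T.parent^[i] x ≠ w := by
      intro h
      rw [h, dist_self] at h₁
      omega
    rw [Function.iterate_succ_apply']
    have h₄ := T.dist_parent _ hne
    have hadj := T.adj_parent _ hne
    refine ⟨by omega, ?_, hadj.reachable.trans h₃⟩
    obtain ⟨p, hp⟩ := h₃.exists_walk_length_eq_dist
    have := dist_le (Walk.cons hadj p)
    rw [Walk.length_cons] at this
    omega

lemma dist_treeVert {w : V} (T : BFSTree G w) {x : V} {k : ℕ} (hk : k ≤ G.dist w x) :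
    G.dist w (treeVert G T x k) = k := by
  have := (T.dist_iterate_parent x (G.dist w x - k) (Nat.sub_le _ _)).1
  rw [treeVert]
  omega

lemma treeVert_mem_interval (hG : G.Connected) {w : V} (T : BFSTree G w) (x : V) (k : ℕ) :
    treeVert G T x k ∈ interval G w x := by
  obtain ⟨h₁, h₂, -⟩ := T.dist_iterate_parent x (G.dist w x - k) (Nat.sub_le _ _)
  have := hG.dist_triangle (u := w) (v := T.parent^[G.dist w x - k] x) (w := x)
  change G.dist w (T.parent^[_] x) + G.dist (T.parent^[_] x) x = _
  omega

lemma treeVert_dist {w : V} (T : BFSTree G w) (x : V) : treeVert G T x (G.dist w x) = x := by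
  simp [treeVert]

lemma floor_gp_le_dist (hG : G.Connected) (x y w : V) :
    ⌊gp G x y w⌋₊ ≤ G.dist w x ∧ ⌊gp G x y w⌋₊ ≤ G.dist w y := by
  have h₁ := ((floor_gp_eq_iff hG x y w _).1 rfl).1
  have h₂ := hG.dist_triangle (u := w) (v := x) (w := y)
  have h₃ := hG.dist_triangle (u := w) (v := y) (w := x)
  rw [G.dist_comm (u := y) (v := x)] at h₃
  omega

lemma dist_treeVert_le_rootedInsize [Finite V] {w : V} (T : BFSTree G w) (x y : V) :
    (G.dist (treeVert G T x ⌊gp G x y w⌋₊) (treeVert G T y ⌊gp G x y w⌋₊) : ℝ) ≤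
      rootedInsize G T := by
  refine le_csSup (Set.Finite.bddAbove ?_) ⟨x, y, rfl⟩
  refine (Set.finite_range fun z : V × V => (G.dist (treeVert G T z.1 ⌊gp G z.1 z.2 w⌋₊)
    (treeVert G T z.2 ⌊gp G z.1 z.2 w⌋₊) : ℝ)).subset ?_
  rintro _ ⟨x, y, rfl⟩
  exact ⟨(x, y), rfl⟩

lemma InsizeBound.rootedInsize_le (hG : G.Connected) {c : ℝ} (h : InsizeBound G c) {w : V}
    (T : BFSTree G w) : rootedInsize G T ≤ c := by
  refine csSup_le ⟨_, w, w, rfl⟩ ?_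
  rintro _ ⟨x, y, rfl⟩
  obtain ⟨hx, hy⟩ := floor_gp_le_dist hG x y w
  obtain ⟨h₁, h₂⟩ := (floor_gp_eq_iff hG x y w _).1 rfl
  have ex := dist_treeVert T hx
  have ey := dist_treeVert T hy
  exact h w x y _ _ (treeVert_mem_interval hG T x _) (treeVert_mem_interval hG T y _)
    (ex.trans ey.symm) (by omega) (by omega)

lemma dist_treeVert_interval_le_rootedInsize [Finite V] (hG : G.Connected) {u v a : V}
    (T : BFSTree G u) (ha : a ∈ interval G u v) :
    (G.dist a (treeVert G T v (G.dist u a)) : ℝ) ≤ rootedInsize G T := by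
  have h := dist_treeVert_le_rootedInsize T a v
  have ha' : G.dist u a + G.dist a v = G.dist u v := ha
  rwa [(floor_gp_eq_iff hG a v u (G.dist u a)).2 ⟨by omega, by omega⟩, treeVert_dist] at h

lemma le_thinness (hG : G.Connected) {t b : ℝ} (hb : ThinBound G b)
    (h : ∀ c, ThinBound G c → t ≤ c) : t ≤ thinness G := by
  rw [thinness_eq_sInf_thinBound hG]
  exact le_csInf ⟨b, hb⟩ h

/-- For a collection `𝒯 = (T_w)_{w ∈ V}` of BFS-trees, with
`ρ_𝒯(G) = max_w ρ_{w,T_w}(G)` and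
`κ_𝒯(G) = max {d(a, u_i) : u, v ∈ V, a ∈ I(u,v), d(u,a) = i}` (where `u_i` is the vertex
of the path from `u` to `v` in `T_u` at distance `i` from `u`):
`ι(G) = τ(G) ≤ ρ_𝒯(G) + 2·κ_𝒯(G) ≤ 3·ρ_𝒯(G) ≤ 3·τ(G)` and
`ς(G) ≤ ρ_𝒯(G) + 2·κ_𝒯(G) ≤ 8·ς(G)`. -/
theorem thinness_slimness_approx_treeFamily
    {V : Type*} [Fintype V] (G : SimpleGraph V) (hG : G.Connected)
    (Tfam : ∀ w : V, BFSTree G w) (ρT κT : ℝ)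
    (hρ : ρT = sSup {r : ℝ | ∃ w : V, r = rootedInsize G (Tfam w)})
    (hκ : κT = sSup {c : ℝ | ∃ u v a : V, a ∈ interval G u v ∧
      c = (G.dist a (treeVert G (Tfam u) v (G.dist u a)) : ℝ)}) :
    (insize G = thinness G ∧ thinness G ≤ ρT + 2 * κT ∧
      ρT + 2 * κT ≤ 3 * ρT ∧ 3 * ρT ≤ 3 * thinness G) ∧
    (slimness G ≤ ρT + 2 * κT ∧ ρT + 2 * κT ≤ 8 * slimness G) := by
  have hρle : ∀ w, rootedInsize G (Tfam w) ≤ ρT := fun w => by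
    rw [hρ]
    refine le_csSup (Set.Finite.bddAbove ?_) ⟨w, rfl⟩
    refine (Set.finite_range fun w => rootedInsize G (Tfam w)).subset ?_
    rintro _ ⟨w, rfl⟩
    exact ⟨w, rfl⟩
  have hκle : ∀ u v a, a ∈ interval G u v →
      (G.dist a (treeVert G (Tfam u) v (G.dist u a)) : ℝ) ≤ κT := fun u v a ha => by
    rw [hκ]
    refine le_csSup (Set.Finite.bddAbove ?_) ⟨u, v, a, ha, rfl⟩
    refine (Set.finite_range fun z : V × V × V =>
      (G.dist z.2.2 (treeVert G (Tfam z.1) z.2.1 (G.dist z.1 z.2.2)) : ℝ)).subset ?_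
    rintro _ ⟨u, v, a, -, rfl⟩
    exact ⟨(u, v, a), rfl⟩
  obtain ⟨v₀⟩ := hG.nonempty
  have hρ_le : ∀ c, (∀ w, rootedInsize G (Tfam w) ≤ c) → ρT ≤ c := fun c h => by
    rw [hρ]
    refine csSup_le ⟨_, v₀, rfl⟩ ?_
    rintro _ ⟨w, rfl⟩
    exact h w
  have hκ_le : ∀ c, (∀ u v a, a ∈ interval G u v →
      (G.dist a (treeVert G (Tfam u) v (G.dist u a)) : ℝ) ≤ c) → κT ≤ c := fun c h => by
    rw [hκ]
    refine csSup_le ⟨_, v₀, v₀, v₀, by simp [interval], rfl⟩ ?_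
    rintro _ ⟨u, v, a, ha, rfl⟩
    exact h u v a ha
  have hκρ : κT ≤ ρT := hκ_le _ fun u v a ha =>
    (dist_treeVert_interval_le_rootedInsize hG (Tfam u) ha).trans (hρle u)
  have hthin : ThinBound G (ρT + 2 * κT) := by
    refine InsizeBound.thinBound hG fun v u u' a b ha hb hab hle hge => ?_
    have h₁ := hκle v u a ha
    have h₂ := hκle v u' b hb
    have h₃ := (dist_treeVert_le_rootedInsize (Tfam v) u u').trans (hρle v)
    rw [(floor_gp_eq_iff hG u u' v (G.dist v a)).2 ⟨hle, hge⟩] at h₃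
    rw [← hab, dist_comm] at h₂
    have t₁ := hG.dist_triangle (u := a) (v := treeVert G (Tfam v) u (G.dist v a)) (w := b)
    have t₂ := hG.dist_triangle (u := treeVert G (Tfam v) u (G.dist v a))
      (v := treeVert G (Tfam v) u' (G.dist v a)) (w := b)
    rify at t₁ t₂
    linarith
  refine ⟨⟨insize_eq_thinness hG, hthin.thinness_le hG, by linarith, ?_⟩,
    (hthin.slimBound hG).slimness_le hG, ?_⟩
  · have : ρT ≤ thinness G := le_thinness hG hthin fun c hc =>
      hρ_le c fun w => ((thinBound_iff_insizeBound hG).1 hc).rootedInsize_le hG (Tfam w)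
    linarith
  · have : (ρT + 2 * κT) / 8 ≤ slimness G := by
      refine le_csInf ⟨_, hthin.slimBound hG⟩ fun c (hc : SlimBound G c) => ?_
      have h₁ : ρT ≤ 4 * c := hρ_le _ fun w => (hc.insizeBound hG).rootedInsize_le hG (Tfam w)
      have h₂ : κT ≤ 2 * c := hκ_le _ fun u v a (ha : _ + _ = _) => by
        have hk : G.dist u a ≤ G.dist u v := by omega
        exact hc.dist_le_two_mul hG ha (treeVert_mem_interval hG (Tfam u) v _)
          (dist_treeVert (Tfam u) hk).symm
      linarith
    linarith

end HypPaper
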